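/- arXiv:1704.08358 — 2 statements merged into one kernel-verified Lean document; each statement's English description precedes it below -/
import Mathlib

section
/- Let f be the odd 5-periodic function f:ℤ→ℚ with f(1)=1, f(2)=-2, f(0)=0 (and f(-n)=-f(n)). Then D_2(1,f) = Σ_{n≥1} d(n) f(n)/n = 0, where d(n) is the number of divisors of n. -/
open scoped Real

noncomputable def xk (k p : ℕ) [NeZero p] (r : ZMod p) : ℝ :=
  ((p : ℝ))⁻¹ ^ k *
    ∑ m ∈ Finset.univ.filter (fun m : Fin k → (ZMod p)ˣ => ∏ i, ((m i : ZMod p)) = r),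
      ∏ i, Real.cot (π * ((m i : ZMod p).val : ℝ) / p)

/-- The `k`-fold divisor function. -/
def dk (k n : ℕ) : ℕ :=
  ((Fintype.piFinset fun _ : Fin k => Finset.range (n + 1)).filter
    (fun f => ∏ i, f i = n)).card

open Finset Filter Topology

/-- tail rate from bounded nonnegative summatory function -/
lemma aux_rate (u U : ℕ → ℝ) (hU : ∀ n, U (n + 1) = U n + u (n + 1))
    (h0 : ∀ n, 0 ≤ U n) (h1 : ∀ n, U n ≤ 1) (A : ℝ) (φ : ℕ → ℕ) (hφ : Tendsto φ atTop atTop)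
    (hA : Tendsto (fun k => ∑ n ∈ Icc 1 (φ k), u n / n) atTop (𝓝 A)) (N : ℕ) :
    |∑ n ∈ Icc 1 N, u n / n - A| ≤ 1 / ((N : ℝ) + 1) := by
  set S : ℕ → ℝ := fun N => ∑ n ∈ Icc 1 N, u n / n with hS
  have hSs : ∀ n, S (n + 1) = S n + u (n + 1) / ((n : ℝ) + 1) := by
    intro n
    simp only [hS]
    rw [Finset.sum_Icc_succ_top (by omega)]
    push_cast
    rfl
  have hT : Monotone (fun N => S N - U N / ((N : ℝ) + 1)) := by
    apply monotone_nat_of_le_succ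
    intro n
    have e : S (n + 1) - U (n + 1) / (((n + 1 : ℕ) : ℝ) + 1) - (S n - U n / ((n : ℝ) + 1))
        = U (n + 1) * (1 / (((n : ℝ) + 1) * ((n : ℝ) + 2))) := by
      rw [hSs, hU]; push_cast; field_simp; ring
    have : 0 ≤ U (n + 1) * (1 / (((n : ℝ) + 1) * ((n : ℝ) + 2))) :=
      mul_nonneg (h0 _) (by positivity)
    linarith
  have hT' : Antitone (fun N => S N - U N / ((N : ℝ) + 1) + 1 / ((N : ℝ) + 1)) := by
    apply antitone_nat_of_succ_le
    intro n
    have e : S (n + 1) - U (n + 1) / (((n + 1 : ℕ) : ℝ) + 1) + 1 / (((n + 1 : ℕ) : ℝ) + 1)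
        - (S n - U n / ((n : ℝ) + 1) + 1 / ((n : ℝ) + 1))
        = - ((1 - U (n + 1)) * (1 / (((n : ℝ) + 1) * ((n : ℝ) + 2)))) := by
      rw [hSs, hU]; push_cast; field_simp; ring
    have : 0 ≤ (1 - U (n + 1)) * (1 / (((n : ℝ) + 1) * ((n : ℝ) + 2))) :=
      mul_nonneg (by linarith [h1 (n + 1)]) (by positivity)
    linarith
  have hz : Tendsto (fun k => 1 / ((φ k : ℝ) + 1)) atTop (𝓝 0) :=
    tendsto_one_div_add_atTop_nhds_zero_nat.comp hφ
  have hz2 : Tendsto (fun k => U (φ k) / ((φ k : ℝ) + 1)) atTop (𝓝 0) := by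
    refine squeeze_zero (fun k => div_nonneg (h0 _) (by positivity)) (fun k => ?_) hz
    gcongr
    exact h1 _
  have l1 : Tendsto (fun k => S (φ k) - U (φ k) / ((φ k : ℝ) + 1)) atTop (𝓝 A) := by
    simpa using hA.sub hz2
  have l2 : Tendsto (fun k => S (φ k) - U (φ k) / ((φ k : ℝ) + 1) + 1 / ((φ k : ℝ) + 1))
      atTop (𝓝 A) := by
    simpa using l1.add hz
  have b1 : S N - U N / ((N : ℝ) + 1) ≤ A := by
    refine ge_of_tendsto l1 ?_
    filter_upwards [hφ.eventually_ge_atTop N] with k hk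
    exact hT hk
  have b2 : A ≤ S N - U N / ((N : ℝ) + 1) + 1 / ((N : ℝ) + 1) := by
    refine le_of_tendsto l2 ?_
    filter_upwards [hφ.eventually_ge_atTop N] with k hk
    exact hT' hk
  have b3 : 0 ≤ U N / ((N : ℝ) + 1) := div_nonneg (h0 _) (by positivity)
  have b4 : U N / ((N : ℝ) + 1) ≤ 1 / ((N : ℝ) + 1) := by
    gcongr
    exact h1 _
  rw [abs_le]
  change _ ≤ S N - A ∧ S N - A ≤ _
  constructor <;> linarith

lemma aux_half (p q : ℕ → ℝ) (B : ℝ) (hp : ∀ n, |p n| ≤ 1 / n)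
    (hQ : ∀ n : ℕ, |∑ k ∈ Icc 1 n, q k - B| ≤ 1 / ((n : ℝ) + 1)) (K N : ℕ) (hN : 0 < N) :
    |∑ a ∈ Icc 1 K, p a * ∑ b ∈ Icc 1 (N / a), q b - (∑ a ∈ Icc 1 K, p a) * B| ≤ K / N := by
  rw [Finset.sum_mul, ← Finset.sum_sub_distrib]
  refine (Finset.abs_sum_le_sum_abs _ _).trans ?_
  have : ∀ a ∈ Icc 1 K, |p a * ∑ b ∈ Icc 1 (N / a), q b - p a * B| ≤ 1 / (N : ℝ) := by
    intro a ha
    rw [Finset.mem_Icc] at ha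
    have ha0 : (0 : ℝ) < a := by exact_mod_cast ha.1
    have hN0 : (0 : ℝ) < N := by exact_mod_cast hN
    rw [← mul_sub, abs_mul]
    have h1 : (N : ℝ) ≤ a * (((N / a : ℕ) : ℝ) + 1) := by
      exact_mod_cast (Nat.lt_mul_div_succ N ha.1).le
    calc _ ≤ 1 / (a : ℝ) * (1 / (((N / a : ℕ) : ℝ) + 1)) :=
          mul_le_mul (hp a) (hQ _) (abs_nonneg _) (by positivity)
      _ = 1 / (a * (((N / a : ℕ) : ℝ) + 1)) := by rw [one_div_mul_one_div]
      _ ≤ 1 / (N : ℝ) := one_div_le_one_div_of_le hN0 h1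
  refine (Finset.sum_le_sum this).trans ?_
  simp [div_eq_mul_inv]

lemma aux_half_sum (p q : ℕ → ℝ) (K N : ℕ) (hK : K ≤ N) :
    ∑ a ∈ Icc 1 N, ∑ b ∈ Icc 1 N, (if a ≤ K ∧ a * b ≤ N then p a * q b else 0)
      = ∑ a ∈ Icc 1 K, p a * ∑ b ∈ Icc 1 (N / a), q b := by
  have hsub : Icc 1 K ⊆ Icc 1 N := Finset.Icc_subset_Icc_right hK
  rw [← Finset.sum_subset hsub]
  · refine Finset.sum_congr rfl fun a ha => ?_
    rw [Finset.mem_Icc] at ha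
    rw [Finset.mul_sum]
    have hs2 : Icc 1 (N / a) ⊆ Icc 1 N := Finset.Icc_subset_Icc_right (Nat.div_le_self _ _)
    rw [← Finset.sum_subset hs2]
    · refine Finset.sum_congr rfl fun b hb => ?_
      rw [Finset.mem_Icc, Nat.le_div_iff_mul_le ha.1] at hb
      rw [if_pos ⟨ha.2, by nlinarith⟩]
    · intro b hb hb'
      rw [Finset.mem_Icc] at hb hb'
      rw [Nat.le_div_iff_mul_le ha.1] at hb'
      rw [if_neg]
      rintro ⟨_, h⟩
      exact hb' ⟨hb.1, by nlinarith⟩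
  · intro a ha ha'
    rw [Finset.mem_Icc] at ha ha'
    refine Finset.sum_eq_zero fun b _ => ?_
    rw [if_neg]
    rintro ⟨h, _⟩
    exact ha' ⟨ha.1, h⟩

lemma aux_hyp (p q : ℕ → ℝ) (N : ℕ) :
    ∑ a ∈ Icc 1 N, ∑ b ∈ Icc 1 N, (if a * b ≤ N then p a * q b else 0)
      = (∑ a ∈ Icc 1 (Nat.sqrt N), p a * ∑ b ∈ Icc 1 (N / a), q b)
        + (∑ a ∈ Icc 1 (Nat.sqrt N), q a * ∑ b ∈ Icc 1 (N / a), p b)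
        - (∑ a ∈ Icc 1 (Nat.sqrt N), p a) * (∑ a ∈ Icc 1 (Nat.sqrt N), q a) := by
  have hK := Nat.sqrt_le_self N
  have hsub : Icc 1 (Nat.sqrt N) ⊆ Icc 1 N := Finset.Icc_subset_Icc_right hK
  have h3 : (∑ a ∈ Icc 1 (Nat.sqrt N), p a) * (∑ a ∈ Icc 1 (Nat.sqrt N), q a)
      = ∑ a ∈ Icc 1 N, ∑ b ∈ Icc 1 N,
        (if a ≤ Nat.sqrt N ∧ b ≤ Nat.sqrt N then p a * q b else 0) := by
    have e : ∀ r : ℕ → ℝ, ∑ a ∈ Icc 1 (Nat.sqrt N), r a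
        = ∑ a ∈ Icc 1 N, if a ≤ Nat.sqrt N then r a else 0 := by
      intro r
      rw [← Finset.sum_filter]
      congr 1
      ext a
      simp only [Finset.mem_filter, Finset.mem_Icc]
      omega
    rw [e p, e q, Finset.sum_mul_sum]
    refine Finset.sum_congr rfl fun a _ => Finset.sum_congr rfl fun b _ => ?_
    split_ifs <;> simp_all
  rw [← aux_half_sum p q _ N hK, ← aux_half_sum q p _ N hK, h3,
    Finset.sum_comm (f := fun a b => if a ≤ Nat.sqrt N ∧ a * b ≤ N then q a * p b else 0),
    ← Finset.sum_add_distrib, ← Finset.sum_sub_distrib]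
  refine Finset.sum_congr rfl fun a _ => ?_
  rw [← Finset.sum_add_distrib, ← Finset.sum_sub_distrib]
  refine Finset.sum_congr rfl fun b _ => ?_
  have f1 : a * b ≤ N → a ≤ Nat.sqrt N ∨ b ≤ Nat.sqrt N := by
    intro h
    by_contra! hc
    have := Nat.sqrt_lt'.1 hc.1
    have h2 := Nat.succ_le_of_lt hc.1
    have h3 := Nat.succ_le_of_lt hc.2
    have h4 := Nat.lt_succ_sqrt N
    have := Nat.mul_le_mul h2 h3
    omega
  have f2 : a ≤ Nat.sqrt N → b ≤ Nat.sqrt N → a * b ≤ N := fun h h' =>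
    (Nat.mul_le_mul h h').trans (Nat.sqrt_le N)
  rw [mul_comm b a, mul_comm (q b)]
  by_cases c1 : a ≤ Nat.sqrt N <;> by_cases c2 : b ≤ Nat.sqrt N <;> by_cases c3 : a * b ≤ N <;>
    simp [c1, c2, c3] <;> tauto

lemma aux_tendsto (p q : ℕ → ℝ) (A B : ℝ) (hp : ∀ n, |p n| ≤ 1 / n) (hq : ∀ n, |q n| ≤ 1 / n)
    (hP : ∀ n : ℕ, |∑ k ∈ Icc 1 n, p k - A| ≤ 1 / ((n : ℝ) + 1))
    (hQ : ∀ n : ℕ, |∑ k ∈ Icc 1 n, q k - B| ≤ 1 / ((n : ℝ) + 1)) :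
    Tendsto (fun N : ℕ =>
      ∑ a ∈ Icc 1 N, ∑ b ∈ Icc 1 N, (if a * b ≤ N then p a * q b else 0)) atTop (𝓝 (A * B)) := by
  have hsq : Tendsto Nat.sqrt atTop atTop := by
    refine tendsto_atTop.2 fun b => ?_
    filter_upwards [eventually_ge_atTop (b * b)] with n hn
    exact Nat.le_sqrt.2 hn
  have lim : ∀ (r : ℕ → ℝ) (R : ℝ),
      (∀ n : ℕ, |∑ k ∈ Icc 1 n, r k - R| ≤ 1 / ((n : ℝ) + 1)) →
      Tendsto (fun N => ∑ k ∈ Icc 1 (Nat.sqrt N), r k) atTop (𝓝 R) := by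
    intro r R h
    have : Tendsto (fun N => ∑ k ∈ Icc 1 N, r k) atTop (𝓝 R) := by
      rw [tendsto_iff_norm_sub_tendsto_zero]
      exact squeeze_zero (fun _ => norm_nonneg _) h tendsto_one_div_add_atTop_nhds_zero_nat
    exact this.comp hsq
  have hKN : Tendsto (fun N : ℕ => (Nat.sqrt N : ℝ) / N) atTop (𝓝 0) := by
    have h1 : Tendsto (fun N : ℕ => 1 / (Nat.sqrt N : ℝ)) atTop (𝓝 0) :=
      tendsto_one_div_atTop_nhds_zero_nat.comp hsq
    refine squeeze_zero' (Eventually.of_forall fun N => by positivity) ?_ h1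
    filter_upwards [eventually_gt_atTop 0] with N hN
    have h2 : (0 : ℝ) < Nat.sqrt N := by exact_mod_cast Nat.sqrt_pos.2 hN
    have h3 : (0 : ℝ) < N := by exact_mod_cast hN
    rw [div_le_div_iff₀ h3 h2, one_mul]
    exact_mod_cast Nat.sqrt_le N
  have half : ∀ (p q : ℕ → ℝ) (A B : ℝ), (∀ n, |p n| ≤ 1 / n) →
      (∀ n : ℕ, |∑ k ∈ Icc 1 n, p k - A| ≤ 1 / ((n : ℝ) + 1)) →
      (∀ n : ℕ, |∑ k ∈ Icc 1 n, q k - B| ≤ 1 / ((n : ℝ) + 1)) →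
      Tendsto (fun N : ℕ => ∑ a ∈ Icc 1 (Nat.sqrt N), p a * ∑ b ∈ Icc 1 (N / a), q b) atTop
        (𝓝 (A * B)) := by
    intro p q A B hp hP hQ
    have h1 : Tendsto (fun N : ℕ => ∑ a ∈ Icc 1 (Nat.sqrt N), p a * ∑ b ∈ Icc 1 (N / a), q b
        - (∑ a ∈ Icc 1 (Nat.sqrt N), p a) * B) atTop (𝓝 0) := by
      rw [tendsto_zero_iff_abs_tendsto_zero]
      refine squeeze_zero' (Eventually.of_forall fun N => abs_nonneg _) ?_ hKN
      filter_upwards [eventually_gt_atTop 0] with N hN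
      exact aux_half p q B hp hQ _ N hN
    have h2 := h1.add ((lim p A hP).mul_const B)
    simpa using h2
  have key := ((half p q A B hp hP hQ).add (half q p B A hq hQ hP)).sub
    ((lim p A hP).mul (lim q B hQ))
  have e : A * B + B * A - A * B = A * B := by ring
  rw [e] at key
  exact key.congr fun N => (aux_hyp p q N).symm

def alf (n : ℕ) : ℝ := if n % 5 = 1 then 1 else if n % 5 = 4 then -1 else 0
def bet (n : ℕ) : ℝ := if n % 5 = 2 then 1 else if n % 5 = 3 then -1 else 0

lemma alf_rate (A : ℝ) (φ : ℕ → ℕ) (hφ : Tendsto φ atTop atTop)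
    (hA : Tendsto (fun k => ∑ n ∈ Icc 1 (φ k), alf n / n) atTop (𝓝 A)) (N : ℕ) :
    |∑ n ∈ Icc 1 N, alf n / n - A| ≤ 1 / ((N : ℝ) + 1) := by
  refine aux_rate alf (fun n => if n % 5 = 1 ∨ n % 5 = 2 ∨ n % 5 = 3 then 1 else 0)
    ?_ ?_ ?_ A φ hφ hA N
  · intro n
    have h : n % 5 < 5 := Nat.mod_lt _ (by norm_num)
    simp only [alf, Nat.add_mod n 1 5]
    interval_cases n % 5 <;> norm_num
  · intro n; split_ifs <;> norm_num
  · intro n; split_ifs <;> norm_num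

lemma bet_rate (A : ℝ) (φ : ℕ → ℕ) (hφ : Tendsto φ atTop atTop)
    (hA : Tendsto (fun k => ∑ n ∈ Icc 1 (φ k), bet n / n) atTop (𝓝 A)) (N : ℕ) :
    |∑ n ∈ Icc 1 N, bet n / n - A| ≤ 1 / ((N : ℝ) + 1) := by
  refine aux_rate bet (fun n => if n % 5 = 2 then 1 else 0)
    ?_ ?_ ?_ A φ hφ hA N
  · intro n
    have h : n % 5 < 5 := Nat.mod_lt _ (by norm_num)
    simp only [bet, Nat.add_mod n 1 5]
    interval_cases n % 5 <;> norm_num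
  · intro n; split_ifs <;> norm_num
  · intro n; split_ifs <;> norm_num

lemma cot_tendsto (x : ℝ) (h0 : 0 < x) (h1 : x < 1) :
    Tendsto (fun n : ℕ => ∑ j ∈ Finset.range n, (1 / (x - (j + 1)) + 1 / (x + (j + 1)))) atTop
      (𝓝 (π * Real.cot (π * x) - 1 / x)) := by
  have hx : (x : ℂ) ∈ Complex.integerComplement := by
    rintro ⟨m, hm⟩
    have : (m : ℝ) = x := by exact_mod_cast hm
    rw [← this] at h0 h1
    have a : 0 < m := by exact_mod_cast h0
    have b : m < 1 := by exact_mod_cast h1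
    omega
  have h := tendsto_logDeriv_euler_cot_sub hx
  have h' := (Complex.continuous_re.tendsto _).comp h
  convert h' using 1
  · funext n
    simp only [Function.comp, cotTerm]
    norm_cast
  · norm_cast

lemma alf_sum (k : ℕ) : ∑ n ∈ Icc 1 (5 * k + 1), alf n / n
    = 1 + 1 / 5 * ∑ j ∈ Finset.range k,
      (1 / ((1 / 5 : ℝ) - (j + 1)) + 1 / ((1 / 5 : ℝ) + (j + 1))) := by
  induction k with
  | zero => simp [alf]
  | succ k ih =>
    rw [Finset.sum_range_succ, mul_add (1 / 5 : ℝ), ← add_assoc, ← ih,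
      show 5 * (k + 1) + 1 = 5 * k + 1 + 1 + 1 + 1 + 1 + 1 by ring]
    iterate 5 rw [Finset.sum_Icc_succ_top (by omega)]
    have hk : (0 : ℝ) ≤ k := by positivity
    have h1 : (1 / 5 : ℝ) - (k + 1) = - ((5 * k + 4) / 5) := by ring
    have h2 : (1 / 5 : ℝ) + (k + 1) = (5 * k + 6) / 5 := by ring
    rw [h1, h2]
    have m2 : (5 * k + 1 + 1) % 5 = 2 := by omega
    have m3 : (5 * k + 1 + 1 + 1) % 5 = 3 := by omega
    have m4 : (5 * k + 1 + 1 + 1 + 1) % 5 = 4 := by omega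
    have m0 : (5 * k + 1 + 1 + 1 + 1 + 1) % 5 = 0 := by omega
    have m1 : (5 * k + 1 + 1 + 1 + 1 + 1 + 1) % 5 = 1 := by omega
    rw [show alf (5 * k + 1 + 1) = 0 by unfold alf; rw [m2]; norm_num,
      show alf (5 * k + 1 + 1 + 1) = 0 by unfold alf; rw [m3]; norm_num,
      show alf (5 * k + 1 + 1 + 1 + 1) = -1 by unfold alf; rw [m4]; norm_num,
      show alf (5 * k + 1 + 1 + 1 + 1 + 1) = 0 by unfold alf; rw [m0]; norm_num,
      show alf (5 * k + 1 + 1 + 1 + 1 + 1 + 1) = 1 by unfold alf; rw [m1]; norm_num]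
    push_cast
    rw [show (5 * (k : ℝ) + 3 + 1) = 5 * k + 4 by ring,
      show (5 * (k : ℝ) + 5 + 1) = 5 * k + 6 by ring]
    field_simp
    ring

lemma bet_sum (k : ℕ) : ∑ n ∈ Icc 1 (5 * k + 2), bet n / n
    = 1 / 2 + 1 / 5 * ∑ j ∈ Finset.range k,
      (1 / ((2 / 5 : ℝ) - (j + 1)) + 1 / ((2 / 5 : ℝ) + (j + 1))) := by
  induction k with
  | zero => simp [bet, Finset.sum_Icc_succ_top]
  | succ k ih =>
    rw [Finset.sum_range_succ, mul_add (1 / 5 : ℝ), ← add_assoc, ← ih,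
      show 5 * (k + 1) + 2 = 5 * k + 2 + 1 + 1 + 1 + 1 + 1 by ring]
    iterate 5 rw [Finset.sum_Icc_succ_top (by omega)]
    have hk : (0 : ℝ) ≤ k := by positivity
    have h1 : (2 / 5 : ℝ) - (k + 1) = - ((5 * k + 3) / 5) := by ring
    have h2 : (2 / 5 : ℝ) + (k + 1) = (5 * k + 7) / 5 := by ring
    rw [h1, h2]
    have m2 : (5 * k + 2 + 1) % 5 = 3 := by omega
    have m3 : (5 * k + 2 + 1 + 1) % 5 = 4 := by omega
    have m4 : (5 * k + 2 + 1 + 1 + 1) % 5 = 0 := by omega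
    have m0 : (5 * k + 2 + 1 + 1 + 1 + 1) % 5 = 1 := by omega
    have m1 : (5 * k + 2 + 1 + 1 + 1 + 1 + 1) % 5 = 2 := by omega
    rw [show bet (5 * k + 2 + 1) = -1 by unfold bet; rw [m2]; norm_num,
      show bet (5 * k + 2 + 1 + 1) = 0 by unfold bet; rw [m3]; norm_num,
      show bet (5 * k + 2 + 1 + 1 + 1) = 0 by unfold bet; rw [m4]; norm_num,
      show bet (5 * k + 2 + 1 + 1 + 1 + 1) = 0 by unfold bet; rw [m0]; norm_num,
      show bet (5 * k + 2 + 1 + 1 + 1 + 1 + 1) = 1 by unfold bet; rw [m1]; norm_num]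
    push_cast
    rw [show (5 * (k : ℝ) + 6 + 1) = 5 * k + 7 by ring,
      show (5 * (k : ℝ) + 2 + 1) = 5 * k + 3 by ring]
    field_simp
    ring

lemma cot_rel : Real.cot (π * (1 / 5)) ^ 2 - Real.cot (π * (2 / 5)) ^ 2
    - 4 * (Real.cot (π * (1 / 5)) * Real.cot (π * (2 / 5))) = 0 := by
  have h2 : π * (2 / 5) = 2 * (π * (1 / 5)) := by ring
  have hq := Real.quadratic_root_cos_pi_div_five
  rw [show π / 5 = π * (1 / 5) by ring] at hq
  rw [h2, Real.cot_eq_cos_div_sin, Real.cot_eq_cos_div_sin, Real.sin_two_mul, Real.cos_two_mul]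
  have hs : 0 < Real.sin (π * (1 / 5)) :=
    Real.sin_pos_of_pos_of_lt_pi (by positivity) (by linarith [Real.pi_pos])
  have hc : 0 < Real.cos (π * (1 / 5)) :=
    Real.cos_pos_of_mem_Ioo ⟨by linarith [Real.pi_pos], by linarith [Real.pi_pos]⟩
  generalize Real.cos (π * (1 / 5)) = c at *
  generalize Real.sin (π * (1 / 5)) = s at *
  have e : (c / s) ^ 2 - ((2 * c ^ 2 - 1) / (2 * s * c)) ^ 2
      - 4 * (c / s * ((2 * c ^ 2 - 1) / (2 * s * c)))
      = -((4 * c ^ 2 - 2 * c - 1) * (4 * c ^ 2 + 2 * c - 1)) / (4 * s ^ 2 * c ^ 2) := by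
    field_simp
    ring
  rw [e, hq]
  simp

lemma dk_two (n : ℕ) (N : ℕ) (h1 : 1 ≤ n) (hN : n ≤ N) :
    dk 2 n = ((Icc 1 N ×ˢ Icc 1 N).filter (fun x : ℕ × ℕ => x.1 * x.2 = n)).card := by
  unfold dk
  refine Finset.card_bij' (fun f _ => (f 0, f 1)) (fun x _ => ![x.1, x.2]) ?_ ?_ ?_ ?_
  · intro f hf
    simp only [Finset.mem_filter, Fintype.mem_piFinset, Fin.prod_univ_two, Finset.mem_product,
      Finset.mem_Icc, Finset.mem_range] at hf ⊢
    have a := hf.1 0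
    have b := hf.1 1
    have c : f 0 ≠ 0 := by intro h; rw [h] at hf; omega
    have d : f 1 ≠ 0 := by intro h; rw [h] at hf; omega
    refine ⟨⟨⟨by omega, by omega⟩, ⟨by omega, by omega⟩⟩, hf.2⟩
  · intro x hx
    simp only [Finset.mem_filter, Fintype.mem_piFinset, Fin.prod_univ_two, Finset.mem_product,
      Finset.mem_Icc, Finset.mem_range, Fin.forall_fin_two] at hx ⊢
    simp only [Matrix.cons_val_zero, Matrix.cons_val_one]
    refine ⟨⟨?_, ?_⟩, hx.2⟩ <;> nlinarith
  · intro f _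
    ext i
    fin_cases i <;> rfl
  · intro x _
    rfl

lemma sum_dk (g : ℕ → ℝ) (N : ℕ) :
    ∑ n ∈ Icc 1 N, (dk 2 n : ℝ) * g n
      = ∑ a ∈ Icc 1 N, ∑ b ∈ Icc 1 N, (if a * b ≤ N then g (a * b) else 0) := by
  have h : ∀ n ∈ Icc 1 N, (dk 2 n : ℝ) * g n
      = ∑ x ∈ Icc 1 N ×ˢ Icc 1 N, if x.1 * x.2 = n then g (x.1 * x.2) else 0 := by
    intro n hn
    rw [Finset.mem_Icc] at hn
    rw [dk_two n N hn.1 hn.2, ← Finset.sum_filter, ← nsmul_eq_mul, ← Finset.sum_const]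
    refine Finset.sum_congr rfl fun x hx => ?_
    rw [(Finset.mem_filter.1 hx).2]
  rw [Finset.sum_congr rfl h, Finset.sum_comm, Finset.sum_product]
  refine Finset.sum_congr rfl fun a ha => Finset.sum_congr rfl fun b hb => ?_
  rw [Finset.mem_Icc] at ha hb
  have : 1 ≤ a * b := Nat.mul_pos ha.1 hb.1
  rw [Finset.sum_ite_eq]
  simp [Finset.mem_Icc, this]

lemma f_mul (f : ℤ → ℚ)
    (hf : f = fun n => if n % 5 = 1 then 1 else if n % 5 = 2 then -2
      else if n % 5 = 3 then 2 else if n % 5 = 4 then -1 else 0) (a b : ℕ) :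
    (f ((a * b : ℕ) : ℤ) : ℝ) = alf a * alf b - bet a * bet b
      - 2 * (alf a * bet b) - 2 * (bet a * alf b) := by
  have h : ∀ m : ℕ, (f (m : ℤ) : ℝ) = if m % 5 = 1 then 1 else if m % 5 = 2 then -2
      else if m % 5 = 3 then 2 else if m % 5 = 4 then -1 else 0 := by
    intro m
    have e : ∀ c : ℕ, ((m : ℤ) % 5 = (c : ℤ)) ↔ m % 5 = c := by intro c; omega
    have e1 := e 1
    have e2 := e 2
    have e3 := e 3
    have e4 := e 4
    push_cast at e1 e2 e3 e4
    subst hf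
    simp only [e1, e2, e3, e4]
    split_ifs <;> norm_num
  rw [h, Nat.mul_mod]
  unfold alf bet
  have ha : a % 5 < 5 := Nat.mod_lt _ (by norm_num)
  have hb : b % 5 < 5 := Nat.mod_lt _ (by norm_num)
  interval_cases a % 5 <;> interval_cases b % 5 <;> norm_num

theorem stmt1
    (f : ℤ → ℚ)
    (hf : f = fun n => if n % 5 = 1 then 1 else if n % 5 = 2 then -2
      else if n % 5 = 3 then 2 else if n % 5 = 4 then -1 else 0) :
    Filter.Tendsto
      (fun N : ℕ => ∑ n ∈ Finset.Icc 1 N, (dk 2 n : ℝ) * (f n : ℝ) / n)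
      Filter.atTop (nhds 0) := by
  set A : ℝ := π / 5 * Real.cot (π * (1 / 5)) with hA
  set B : ℝ := π / 5 * Real.cot (π * (2 / 5)) with hB
  have lA : Tendsto (fun k => ∑ n ∈ Icc 1 (5 * k + 1), alf n / n) atTop (𝓝 A) := by
    simp_rw [alf_sum]
    have := ((cot_tendsto (1 / 5) (by norm_num) (by norm_num)).const_mul (1 / 5)).const_add 1
    convert this using 2
    rw [hA]; ring
  have lB : Tendsto (fun k => ∑ n ∈ Icc 1 (5 * k + 2), bet n / n) atTop (𝓝 B) := by
    simp_rw [bet_sum]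
    have := ((cot_tendsto (2 / 5) (by norm_num) (by norm_num)).const_mul (1 / 5)).const_add (1 / 2)
    convert this using 2
    rw [hB]; ring
  have rA := alf_rate A (fun k => 5 * k + 1) (tendsto_atTop_mono (fun k => by dsimp only [id]; omega) tendsto_id) lA
  have rB := bet_rate B (fun k => 5 * k + 2) (tendsto_atTop_mono (fun k => by dsimp only [id]; omega) tendsto_id) lB
  have pA : ∀ n : ℕ, |alf n / n| ≤ 1 / n := by
    intro n
    rw [abs_div, Nat.abs_cast]
    gcongr
    unfold alf
    split_ifs <;> norm_num
  have pB : ∀ n : ℕ, |bet n / n| ≤ 1 / n := by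
    intro n
    rw [abs_div, Nat.abs_cast]
    gcongr
    unfold bet
    split_ifs <;> norm_num
  have key := (((aux_tendsto _ _ A A pA pA rA rA).sub (aux_tendsto _ _ B B pB pB rB rB)).sub
    ((aux_tendsto _ _ A B pA pB rA rB).const_mul 2)).sub
    ((aux_tendsto _ _ B A pB pA rB rA).const_mul 2)
  have e : A * A - B * B - 2 * (A * B) - 2 * (B * A) = 0 := by
    rw [hA, hB]
    linear_combination (π / 5) ^ 2 * cot_rel
  rw [e] at key
  refine key.congr fun N => ?_
  simp_rw [mul_div_assoc]
  rw [sum_dk (fun n => (f n : ℝ) / n)]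
  simp only [Finset.mul_sum, ← Finset.sum_sub_distrib]
  refine Finset.sum_congr rfl fun a _ => Finset.sum_congr rfl fun b _ => ?_
  rw [f_mul f hf]
  split_ifs
  · push_cast
    ring
  · simp
end

section
/- Let p≥3 be prime, k≥2, and f:ℤ→ℂ periodic modulo p. The function D_k(s,f), initially defined for Re(s)>1, extends to an entire function on ℂ if and only if f(0)=0 and Σ_{a mod p} f(a) = 0. -/
open scoped Real

open Filter Topology LSeries.notation

lemma dk_eq (k n : ℕ) (hn : n ≠ 0) : dk k n = (Nat.finMulAntidiag k n).card := by
  unfold dk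
  congr 1
  ext f
  simp only [Finset.mem_filter, Fintype.mem_piFinset, Finset.mem_range, Nat.mem_finMulAntidiag]
  constructor
  · rintro ⟨_, h⟩
    exact ⟨h, hn⟩
  · rintro ⟨h, _⟩
    refine ⟨fun i => ?_, h⟩
    have : f i ∣ n := h ▸ Finset.dvd_prod_of_mem f (Finset.mem_univ i)
    exact Nat.lt_succ_of_le (Nat.le_of_dvd (Nat.pos_of_ne_zero hn) this)

lemma card_fma_succ (k n : ℕ) : (Nat.finMulAntidiag (k+1) n).card =
    ∑ x ∈ n.divisorsAntidiagonal, (Nat.finMulAntidiag k x.2).card := by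
  rw [← Finset.card_sigma]
  refine Finset.card_bij' (fun f _ => ⟨(f 0, ∏ i : Fin k, f i.succ), fun i => f i.succ⟩)
    (fun x _ => Fin.cons x.1.1 x.2) ?_ ?_ ?_ ?_
  · intro f hf
    simp only [Nat.mem_finMulAntidiag, Fin.prod_univ_succ] at hf
    obtain ⟨h, hn⟩ := hf
    simp only [Finset.mem_sigma, Nat.mem_divisorsAntidiagonal, Nat.mem_finMulAntidiag]
    refine ⟨⟨h, hn⟩, trivial, ?_⟩
    rintro h0
    exact hn (by rw [← h, h0, mul_zero])
  · rintro ⟨⟨a, b⟩, f⟩ hf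
    simp only [Finset.mem_sigma, Nat.mem_divisorsAntidiagonal, Nat.mem_finMulAntidiag] at hf
    simp only [Nat.mem_finMulAntidiag, Fin.prod_univ_succ, Fin.cons_zero, Fin.cons_succ]
    obtain ⟨⟨h, hn⟩, h2, _⟩ := hf
    exact ⟨by rw [h2, h], hn⟩
  · intro f hf
    exact Fin.cons_self_tail f
  · rintro ⟨⟨a, b⟩, f⟩ hf
    simp only [Finset.mem_sigma, Nat.mem_divisorsAntidiagonal, Nat.mem_finMulAntidiag] at hf
    obtain ⟨_, h2, _⟩ := hf
    subst h2
    simp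

lemma hasSum_char {N : ℕ} [NeZero N] (χ : DirichletCharacter ℂ N) (k : ℕ) {s : ℂ}
    (hs : 1 < s.re) :
    LSeriesHasSum (fun n => χ n * (Nat.finMulAntidiag k n).card) s
      (DirichletCharacter.LFunction χ s ^ k) := by
  induction k with
  | zero =>
    have h : (fun n : ℕ => χ n * ((Nat.finMulAntidiag 0 n).card : ℂ)) = LSeries.delta := by
      ext n
      rcases eq_or_ne n 1 with rfl | hn
      · simp [LSeries.delta, Nat.finMulAntidiag_one]
      · simp [LSeries.delta, Nat.finMulAntidiag_zero_left hn, hn]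
    rw [h, pow_zero]
    unfold LSeriesHasSum
    have h' : LSeries.term LSeries.delta s = fun n => if n = 1 then 1 else 0 := by
      ext n
      simp only [LSeries.term_delta]
    rw [h']
    exact hasSum_ite_eq 1 1
  | succ k ih =>
    have h1 : LSeriesHasSum (fun n => χ n) s (DirichletCharacter.LFunction χ s) := by
      rw [DirichletCharacter.LFunction_eq_LSeries χ hs]
      exact (DirichletCharacter.LSeriesSummable_of_one_lt_re χ hs).LSeriesHasSum
    have h2 := LSeriesHasSum.convolution h1 ih
    rw [pow_succ']
    convert! h2 using 1
    rw [LSeries.convolution_def]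
    ext n
    rw [card_fma_succ]
    push_cast
    rw [Finset.mul_sum]
    refine Finset.sum_congr rfl fun x hx => ?_
    rw [← (Nat.mem_divisorsAntidiagonal.mp hx).1]
    push_cast
    rw [map_mul]
    ring

lemma analytic_part (p k : ℕ) (hp : p.Prime) (hk : 2 ≤ k) (a b : ℂ) (h : ℂ → ℂ)
    (hd : Differentiable ℂ h)
    (heq : ∀ s : ℂ, 1 < s.re →
      h s = riemannZeta s ^ k * (a + b * (1 - (p : ℂ) ^ (-s)) ^ k)) :
    a = 0 ∧ b = 0 := by
  have hp0 : (p : ℂ) ≠ 0 := by exact_mod_cast hp.ne_zero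
  set E : ℂ → ℂ := fun s => a + b * (1 - (p : ℂ) ^ (-s)) ^ k with hE
  set E' : ℂ := b * (k * (1 - (p : ℂ) ^ (-1 : ℂ)) ^ (k - 1) *
    ((p : ℂ) ^ (-1 : ℂ) * Complex.log p)) with hE'
  have hder : HasDerivAt E E' 1 := by
    have h1 : HasDerivAt (fun s : ℂ => (p : ℂ) ^ (-s))
        ((p : ℂ) ^ (-1 : ℂ) * Complex.log p * (-1)) 1 :=
      (hasDerivAt_neg (1 : ℂ)).const_cpow (Or.inl hp0)
    have h2 := (((h1.const_sub 1).pow k).const_mul b).const_add a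
    convert! h2 using 1
    rw [hE']; ring
  set l : Filter ℂ := Filter.map (fun x : ℝ => (x : ℂ)) (𝓝[>] (1 : ℝ)) with hl
  have : l.NeBot := by rw [hl]; infer_instance
  have hre : ∀ᶠ s in l, 1 < s.re := by
    rw [hl, Filter.eventually_map]
    filter_upwards [self_mem_nhdsWithin] with x hx
    simpa using hx
  have hl1 : l ≤ 𝓝[≠] 1 := by
    rw [nhdsWithin, le_inf_iff]
    constructor
    · have : Tendsto (fun x : ℝ => (x : ℂ)) (𝓝[>] (1 : ℝ)) (𝓝 ((1 : ℝ) : ℂ)) :=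
        (Complex.continuous_ofReal.tendsto 1).mono_left nhdsWithin_le_nhds
      rw [Complex.ofReal_one] at this
      exact this
    · rw [Filter.le_principal_iff]
      filter_upwards [hre] with s hs
      rintro rfl
      simp at hs
  have hl2 : l ≤ 𝓝 1 := hl1.trans nhdsWithin_le_nhds
  have hz : Tendsto (fun s => ((s - 1) * riemannZeta s) ^ k) l (𝓝 1) := by
    simpa using (riemannZeta_residue_one.mono_left hl1).pow k
  have hh : Tendsto h l (𝓝 (h 1)) := (hd.continuous.tendsto 1).mono_left hl2
  have hs0 : Tendsto (fun s : ℂ => s - 1) l (𝓝 0) := by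
    have : Tendsto (fun s : ℂ => s - 1) (𝓝 1) (𝓝 (1 - 1)) := by
      exact (continuous_id.sub continuous_const).tendsto 1
    rw [sub_self] at this
    exact this.mono_left hl2
  have hE1 : E 1 = 0 := by
    have t1 : Tendsto (fun s => ((s - 1) * riemannZeta s) ^ k * E s) l (𝓝 (1 * E 1)) :=
      hz.mul (hder.continuousAt.tendsto.mono_left hl2)
    have t2 : Tendsto (fun s => (s - 1) ^ k * h s) l (𝓝 (0 ^ k * h 1)) := (hs0.pow k).mul hh
    have := tendsto_nhds_unique_of_eventuallyEq t1 t2 (by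
      filter_upwards [hre] with s hs
      rw [heq s hs, mul_pow]; simp only [hE]; ring)
    rwa [one_mul, zero_pow (by omega), zero_mul] at this
  have hE2 : E' = 0 := by
    have ts : Tendsto (slope E 1) l (𝓝 E') := (hasDerivAt_iff_tendsto_slope.mp hder).mono_left hl1
    have t1 : Tendsto (fun s => ((s - 1) * riemannZeta s) ^ k * slope E 1 s) l (𝓝 (1 * E')) :=
      hz.mul ts
    have t2 : Tendsto (fun s => (s - 1) ^ (k - 1) * h s) l (𝓝 (0 ^ (k - 1) * h 1)) :=
      (hs0.pow (k - 1)).mul hh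
    have := tendsto_nhds_unique_of_eventuallyEq t1 t2 (by
      filter_upwards [hre] with s hs
      have hne : s - 1 ≠ 0 := by
        intro h0
        rw [sub_eq_zero] at h0
        rw [h0] at hs
        simp at hs
      obtain ⟨m, rfl⟩ : ∃ m, k = m + 1 := ⟨k - 1, by omega⟩
      rw [heq s hs, slope_def_field, hE1, sub_zero, Nat.add_sub_cancel]
      simp only [hE]
      rw [mul_pow, pow_succ (s - 1)]
      field_simp)
    rwa [one_mul, zero_pow (by omega), zero_mul] at this
  have hb : b = 0 := by
    rw [hE', mul_eq_zero] at hE2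
    rcases hE2 with h0 | h0
    · exact h0
    exfalso
    have hlog : Complex.log p ≠ 0 := by
      rw [← Complex.natCast_log]
      exact_mod_cast (Real.log_pos (by exact_mod_cast hp.one_lt)).ne'
    have hu : (1 - (p : ℂ) ^ (-1 : ℂ)) ≠ 0 := by
      rw [Complex.cpow_neg_one, sub_ne_zero]
      intro h1
      have : (p : ℂ) = 1 := by rw [← inv_inv (p : ℂ), ← h1, inv_one]
      exact hp.ne_one (by exact_mod_cast this)
    have hk0 : (k : ℂ) ≠ 0 := by exact_mod_cast (by omega : k ≠ 0)
    have hc : (p : ℂ) ^ (-1 : ℂ) ≠ 0 := by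
      rw [Complex.cpow_neg_one]; exact inv_ne_zero hp0
    exact mul_ne_zero (mul_ne_zero hk0 (pow_ne_zero _ hu)) (mul_ne_zero hc hlog) h0
  refine ⟨?_, hb⟩
  simpa [hE, hb] using hE1

lemma decomp (p : ℕ) [Fact p.Prime] (F : ZMod p → ℂ) (x : ZMod p) :
    F x = F 0 * (1 - (1 : DirichletCharacter ℂ p) x) +
      ∑ χ : DirichletCharacter ℂ p,
        ((p.totient : ℂ)⁻¹ * ∑ a : ZMod p, F a * χ a⁻¹) * χ x := by
  have hφ : (p.totient : ℂ) ≠ 0 := by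
    exact_mod_cast (Nat.totient_pos.mpr (Fact.out : p.Prime).pos).ne'
  rcases eq_or_ne x 0 with rfl | hx
  · have : ∀ χ : DirichletCharacter ℂ p, χ 0 = 0 := fun χ => χ.map_nonunit not_isUnit_zero
    simp [this]
  · rw [MulChar.one_apply (isUnit_iff_ne_zero.mpr hx), sub_self, mul_zero, zero_add]
    have h1 : ∀ a : ZMod p, ∑ χ : DirichletCharacter ℂ p, χ a⁻¹ * χ x =
        if a = x then (p.totient : ℂ) else 0 := by
      intro a
      rcases eq_or_ne a 0 with rfl | ha
      · have : ∀ χ : DirichletCharacter ℂ p, χ 0 = 0 := fun χ => χ.map_nonunit not_isUnit_zero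
        simp [this, hx.symm]
      · exact DirichletCharacter.sum_char_inv_mul_char_eq ℂ (isUnit_iff_ne_zero.mpr ha) x
    simp_rw [mul_assoc, ← Finset.mul_sum, Finset.sum_mul]
    rw [Finset.sum_comm]
    simp_rw [mul_assoc, ← Finset.mul_sum, h1]
    simp only [mul_ite, mul_zero, Finset.sum_ite_eq', Finset.mem_univ, if_true]
    field_simp

lemma main_sum (p k : ℕ) [Fact p.Prime] (F : ZMod p → ℂ) (c : DirichletCharacter ℂ p → ℂ)
    (hF : ∀ x, F x = F 0 * (1 - (1 : DirichletCharacter ℂ p) x) + ∑ χ, c χ * χ x)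
    {s : ℂ} (hs : 1 < s.re) :
    ∑' n : ℕ, (dk k (n + 1) : ℂ) * F ((n + 1 : ℕ) : ZMod p) / ((n : ℂ) + 1) ^ s =
      riemannZeta s ^ k * (F 0 + (c 1 - F 0) * (1 - (p : ℂ) ^ (-s)) ^ k) +
        ∑ χ ∈ Finset.univ.erase 1, c χ * DirichletCharacter.LFunction χ s ^ k := by
  have hs1 : s ≠ 1 := by rintro rfl; simp at hs
  have hz := hasSum_char (1 : DirichletCharacter ℂ 1) k hs
  have h1 := hasSum_char (1 : DirichletCharacter ℂ p) k hs
  rw [DirichletCharacter.LFunction_modOne_eq] at hz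
  have hL1 : DirichletCharacter.LFunction (1 : DirichletCharacter ℂ p) s =
      (1 - (p : ℂ) ^ (-s)) * riemannZeta s := by
    have := DirichletCharacter.LFunctionTrivChar_eq_mul_riemannZeta (N := p) hs1
    rwa [(Fact.out : p.Prime).primeFactors, Finset.prod_singleton] at this
  have hsum : HasSum (fun n : ℕ => ∑ χ : DirichletCharacter ℂ p,
      c χ * LSeries.term (fun n => χ n * ((Nat.finMulAntidiag k n).card : ℂ)) s n)
      (∑ χ : DirichletCharacter ℂ p, c χ * DirichletCharacter.LFunction χ s ^ k) :=
    hasSum_sum fun χ _ => HasSum.mul_left (c χ) (hasSum_char χ k hs)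
  have htot := ((HasSum.sub hz h1).mul_left (F 0)).add hsum
  rw [← hasSum_nat_add_iff' 1] at htot
  have hval := htot.tsum_eq
  simp only [Finset.range_one, Finset.sum_singleton, LSeries.term_zero, sub_self, mul_zero,
    Finset.sum_const_zero, add_zero, sub_zero] at hval
  rw [← Finset.add_sum_erase _ _ (Finset.mem_univ (1 : DirichletCharacter ℂ p)), hL1] at hval
  refine Eq.trans (tsum_congr fun n => ?_) (hval.trans ?_)
  · have hn : n + 1 ≠ 0 := Nat.succ_ne_zero n
    rw [dk_eq k _ hn, hF]
    simp only [LSeries.term_of_ne_zero hn]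
    rw [MulChar.one_apply (isUnit_of_subsingleton ((n + 1 : ℕ) : ZMod 1))]
    rw [mul_add, add_div, Finset.mul_sum, Finset.sum_div]
    push_cast
    congr 1
    · ring
    · refine Finset.sum_congr rfl fun χ _ => ?_
      ring
  · rw [mul_pow]; ring

theorem stmt10 (p k : ℕ) (hp : p.Prime) (hp3 : 3 ≤ p) (hk : 2 ≤ k)
    (f : ℤ → ℂ) (hper : ∀ n : ℤ, f (n + p) = f n) :
    (∃ g : ℂ → ℂ, Differentiable ℂ g ∧
      ∀ s : ℂ, 1 < s.re →
        g s = ∑' n : ℕ, (dk k (n + 1) : ℂ) * f (n + 1) / ((n : ℂ) + 1) ^ s) ↔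
    (f 0 = 0 ∧ ∑ a ∈ Finset.range p, f a = 0) := by
  have : Fact p.Prime := ⟨hp⟩
  have hper' : Function.Periodic f (p : ℤ) := hper
  set F : ZMod p → ℂ := fun a => f (a.val : ℤ) with hFdef
  have hfF : ∀ n : ℕ, f (n : ℤ) = F (n : ZMod p) := by
    intro n
    simp only [hFdef, ZMod.val_natCast]
    have := hper'.nat_mul (n / p) ((n % p : ℕ) : ℤ)
    rw [← this]
    congr 1
    have h := Nat.mod_add_div n p
    rw [mul_comm] at h
    exact (congrArg (Nat.cast : ℕ → ℤ) h.symm).trans (by rw [Nat.cast_add, Nat.cast_mul])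
  have hF0 : F 0 = f 0 := by simp [hFdef]
  set c : DirichletCharacter ℂ p → ℂ :=
    fun χ => (p.totient : ℂ)⁻¹ * ∑ a : ZMod p, F a * χ a⁻¹ with hc
  have hdec := decomp p F
  have hsumF : ∑ a ∈ Finset.range p, f a = ∑ a : ZMod p, F a := by
    refine Finset.sum_bij' (fun n _ => (n : ZMod p)) (fun a _ => a.val) ?_ ?_ ?_ ?_ ?_
    · intro n _; exact Finset.mem_univ _
    · intro a _; exact Finset.mem_range.mpr (ZMod.val_lt a)
    · intro n hn; exact ZMod.val_cast_of_lt (Finset.mem_range.mp hn)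
    · intro a _; exact ZMod.natCast_zmod_val a
    · intro n _; exact hfF n
  have hφ : (p.totient : ℂ) ≠ 0 := by
    exact_mod_cast (Nat.totient_pos.mpr hp.pos).ne'
  have hc1 : (p.totient : ℂ) * c 1 = ∑ a : ZMod p, F a - F 0 := by
    simp only [hc]
    rw [mul_inv_cancel_left₀ hφ, eq_sub_iff_add_eq,
      ← Finset.add_sum_erase _ _ (Finset.mem_univ (0 : ZMod p)),
      ← Finset.add_sum_erase _ F (Finset.mem_univ (0 : ZMod p)), inv_zero,
      MulChar.map_nonunit _ not_isUnit_zero, mul_zero, zero_add, add_comm]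
    congr 1
    refine Finset.sum_congr rfl fun a ha => ?_
    rw [MulChar.one_apply (isUnit_iff_ne_zero.mpr (inv_ne_zero (Finset.ne_of_mem_erase ha))),
      mul_one]
  set G : ℂ → ℂ := fun s =>
    ∑ χ ∈ Finset.univ.erase (1 : DirichletCharacter ℂ p),
      c χ * DirichletCharacter.LFunction χ s ^ k with hG
  have hGd : Differentiable ℂ G := by
    refine Differentiable.fun_sum fun χ hχ => ?_
    exact ((DirichletCharacter.differentiable_LFunction (Finset.ne_of_mem_erase hχ)).pow k).const_mul _
  have hD : ∀ s : ℂ, 1 < s.re →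
      ∑' n : ℕ, (dk k (n + 1) : ℂ) * f (n + 1) / ((n : ℂ) + 1) ^ s =
      riemannZeta s ^ k * (F 0 + (c 1 - F 0) * (1 - (p : ℂ) ^ (-s)) ^ k) + G s := by
    intro s hs
    rw [← main_sum p k F c hdec hs]
    refine tsum_congr fun n => ?_
    rw [← hfF (n + 1)]
    push_cast
    rfl
  rw [hsumF, ← hF0]
  constructor
  · rintro ⟨g, hg, hgs⟩
    obtain ⟨ha, hb⟩ := analytic_part p k hp hk (F 0) (c 1 - F 0) (fun s => g s - G s)
      (hg.sub hGd) (fun s hs => by rw [hgs s hs, hD s hs, add_sub_cancel_right])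
    refine ⟨ha, ?_⟩
    rw [ha, sub_zero] at hb
    rw [ha, hb, mul_zero, sub_zero] at hc1
    exact hc1.symm
  · rintro ⟨h0, hS⟩
    refine ⟨G, hGd, fun s hs => ?_⟩
    rw [h0, hS, sub_zero, mul_eq_zero] at hc1
    rw [hD s hs, h0, hc1.resolve_left hφ]
    simp
end
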